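/- Let (W,S) be a finite Coxeter system. For all subsets J, K of S, the product of the coset-representative sums satisfies 𝒳_J · 𝒳_K = Σ_{L ⊆ S} a_{JKL} 𝒳_L in the group algebra ℚ[W], where a_{JKL} is the number of elements x ∈ X_J^{-1} ∩ X_K such that x^{-1} J x ∩ K = L. In particular, the ℚ-span of {𝒳_J : J ⊆ S} is a subalgebra of ℚ[W] (the descent algebra of W). -/

import Mathlib

open scoped Classical

namespace SolomonRule

variable {B : Type*} {W : Type*} [Group W] {M : CoxeterMatrix B}

/-- The standard parabolic subgroup `W_J`, generated by the simple reflections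
indexed by `J`. -/
def WJ (cs : CoxeterSystem M W) (J : Set B) : Subgroup W :=
  Subgroup.closure (cs.simple '' J)

/-- `X_J`: the set of minimal length left coset representatives of `W_J` in `W`. -/
def Xleft (cs : CoxeterSystem M W) (J : Set B) : Set W :=
  {w | ∀ u ∈ WJ cs J, cs.length w ≤ cs.length (w * u)}

/-- `X_J⁻¹`: the set of minimal length right coset representatives of `W_J` in `W`. -/
def Xright (cs : CoxeterSystem M W) (J : Set B) : Set W :=
  {w | ∀ u ∈ WJ cs J, cs.length w ≤ cs.length (u * w)}

/-- `𝒳_J`: the formal sum, in the group algebra `ℚ[W]`, of the elements of `X_J`. -/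
noncomputable def XX [Fintype W] (cs : CoxeterSystem M W) (J : Set B) :
    MonoidAlgebra ℚ W :=
  ∑ w : W, if w ∈ Xleft cs J then MonoidAlgebra.of ℚ W w else 0

/-- The structure constant `a_{JKL}`: the number of `x ∈ X_J⁻¹ ∩ X_K` such that
`x⁻¹ J x ∩ K = L`. -/
noncomputable def aJKL (cs : CoxeterSystem M W) (J K L : Set B) : ℕ :=
  Nat.card {x : W | x ∈ Xright cs J ∧ x ∈ Xleft cs K ∧
    (fun s => x⁻¹ * s * x) '' (cs.simple '' J) ∩ (cs.simple '' K) = cs.simple '' L}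

section Injective

open Module

theorem reflection_mul_reflection_pow_eq_one {V : Type*} [AddCommGroup V] [Module ℝ V]
    {x y : V} {f g : Dual ℝ V} (hf : f x = 2) (hg : g y = 2) {m : ℕ} (hm : 2 ≤ m)
    (hfy : f y = -2 * Real.cos (Real.pi / m)) (hgx : g x = -2 * Real.cos (Real.pi / m)) :
    (reflection hf * reflection hg) ^ m = 1 := by
  obtain ⟨θ, hθ⟩ : ∃ θ, θ = 2 * Real.pi / m := ⟨_, rfl⟩
  have hm0 : (m : ℝ) ≠ 0 := by positivity
  have ht : 2 * Real.cos θ = f y * g x - 2 := by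
    rw [hfy, hgx, hθ, mul_div_assoc, Real.cos_two_mul]; ring
  ext z
  rw [reflection_mul_reflection_pow_apply hf hg m z _ ht, show (1 : V ≃ₗ[ℝ] V) z = z from rfl]
  rcases hm.eq_or_lt with rfl | hm'
  · have hfy0 : f y = 0 := by simp [hfy]
    have hgx0 : g x = 0 := by simp [hgx]
    have hc : 2 * Real.cos θ = -2 := by simp [ht, hfy0]
    simp [hfy0, hgx0, hc, Polynomial.Chebyshev.S_zero, Polynomial.Chebyshev.S_one]
    norm_num
    abel
  have hsin : Real.sin θ ≠ 0 := by
    apply ne_of_gt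
    apply Real.sin_pos_of_pos_of_lt_pi
    · rw [hθ]; positivity
    · rw [hθ, div_lt_iff₀ (by positivity), mul_comm]
      exact mul_lt_mul_of_pos_left (by exact_mod_cast hm') Real.pi_pos
  have key := Polynomial.Chebyshev.S_two_mul_real_cos θ
  obtain ⟨p, rfl | rfl⟩ := Nat.even_or_odd' m
  · have h0 : (Polynomial.Chebyshev.S ℝ (p - 1)).eval (2 * Real.cos θ) = 0 := by
      apply (mul_eq_zero.mp _).resolve_right hsin
      rw [key, hθ]
      have : ((((p : ℤ) - 1 : ℤ) : ℝ) + 1) * (2 * Real.pi / (2 * p : ℕ)) = Real.pi := by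
        have hp : (p : ℝ) ≠ 0 := by
          rintro h
          simp [h] at hm0
        push_cast
        field_simp
        ring
      rw [this, Real.sin_pi]
    have e1 : (((2 * p : ℕ) : ℤ) - 2) / 2 = p - 1 := by omega
    have e2 : (((2 * p : ℕ) : ℤ) - 1) / 2 = p - 1 := by omega
    rw [e1, e2, h0]
    simp
  · have h0 : (Polynomial.Chebyshev.S ℝ p).eval (2 * Real.cos θ) +
        (Polynomial.Chebyshev.S ℝ (p - 1)).eval (2 * Real.cos θ) = 0 := by
      apply (mul_eq_zero.mp _).resolve_right hsin
      rw [add_mul, key, key]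
      have : ((p : ℤ) + 1 : ℝ) * θ = 2 * Real.pi - ((((p : ℤ) - 1 : ℤ) : ℝ) + 1) * θ := by
        rw [hθ]
        push_cast at hm0 ⊢
        field_simp
        ring
      rw [this, Real.sin_two_pi_sub]
      ring
    have e1 : (((2 * p + 1 : ℕ) : ℤ) - 1) / 2 = p := by omega
    have e2 : (((2 * p + 1 : ℕ) : ℤ) - 3) / 2 = p - 1 := by omega
    have e3 : (((2 * p + 1 : ℕ) : ℤ) - 2) / 2 = p - 1 := by omega
    have e4 : (((2 * p + 1 : ℕ) : ℤ)) / 2 = p := by omega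
    rw [e1, e2, e3, e4, h0]
    simp

/-- The functional `v ↦ 2 B(e_i, v)` of the geometric representation. -/
noncomputable def geomCoroot (M : CoxeterMatrix B) (i : B) : Dual ℝ (B →₀ ℝ) :=
  Finsupp.linearCombination ℝ fun j => -2 * Real.cos (Real.pi / M i j)

theorem geomCoroot_single (M : CoxeterMatrix B) (i j : B) :
    geomCoroot M i (Finsupp.single j 1) = -2 * Real.cos (Real.pi / M i j) := by
  simp [geomCoroot]

theorem geomCoroot_self (M : CoxeterMatrix B) (i : B) :
    geomCoroot M i (Finsupp.single i 1) = 2 := by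
  simp [geomCoroot_single]

theorem isLiftable_reflection (M : CoxeterMatrix B) :
    M.IsLiftable fun i => reflection (geomCoroot_self M i) := by
  intro i j
  by_cases hij : i = j
  · subst hij
    rw [M.diagonal, pow_one]
    rw [mul_eq_one_iff_inv_eq, reflection_inv]
  have h1 := M.off_diagonal i j hij
  rcases Nat.eq_zero_or_pos (M i j) with h0 | h0
  · rw [h0, pow_zero]
  · exact reflection_mul_reflection_pow_eq_one _ _ (by omega) (geomCoroot_single M i j)
      (by rw [geomCoroot_single, M.symmetric])

theorem simple_injective (cs : CoxeterSystem M W) : Function.Injective cs.simple := by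
  intro i j h
  by_contra hij
  have h1 : reflection (geomCoroot_self M i) = reflection (geomCoroot_self M j) := by
    rw [← cs.lift_apply_simple (isLiftable_reflection M) i, h, cs.lift_apply_simple]
  have h2 := DFunLike.congr_fun (LinearEquiv.congr_fun h1 (Finsupp.single i 1)) i
  rw [reflection_apply_self, reflection_apply] at h2
  simp [Finsupp.single_eq_of_ne hij] at h2
  norm_num at h2

end Injective
section Cocycle

variable (cs : CoxeterSystem M W)

theorem end_mul_apply {X : Type*} (f g : Function.End X) (x : X) : (f * g) x = f (g x) := rfl

theorem end_one_apply {X : Type*} (x : X) : (1 : Function.End X) x = x := rfl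

/-- The action of a simple reflection on `W × ZMod 2` underlying the inversion cocycle. -/
noncomputable def signedConj (i : B) : Function.End (W × ZMod 2) := fun p =>
  (cs.simple i * p.1 * cs.simple i, p.2 + if p.1 = cs.simple i then 1 else 0)

theorem signedConj_mul_pow_apply (i j : B) (n : ℕ) (t : W) (ε : ZMod 2) :
    ((signedConj cs i * signedConj cs j) ^ n : Function.End (W × ZMod 2)) (t, ε) =
      ((cs.simple i * cs.simple j) ^ n * t * ((cs.simple i * cs.simple j) ^ n)⁻¹,
        ε + ∑ r ∈ Finset.range (2 * n),
          if (cs.simple i * cs.simple j) ^ r * t = cs.simple j then 1 else 0) := by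
  induction n with
  | zero => simp [end_one_apply]
  | succ n ih =>
    obtain ⟨ρ, hρ⟩ : ∃ ρ, ρ = cs.simple i * cs.simple j := ⟨_, rfl⟩
    have hj : cs.simple j * ρ ^ n = (ρ ^ n)⁻¹ * cs.simple j := by
      have : cs.simple j * ρ * (cs.simple j)⁻¹ = ρ⁻¹ := by simp [hρ, mul_assoc]
      rw [← inv_pow, ← this, conj_pow]
      simp
    have hij : cs.simple j * cs.simple i * cs.simple j = ρ⁻¹ * cs.simple j := by simp [hρ, mul_assoc]
    have c1 : ρ ^ n * t * (ρ ^ n)⁻¹ = cs.simple j ↔ ρ ^ (2 * n) * t = cs.simple j := by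
      rw [mul_inv_eq_iff_eq_mul, hj, eq_inv_mul_iff_mul_eq, two_mul, pow_add, mul_assoc]
    have c2 : cs.simple j * (ρ ^ n * t * (ρ ^ n)⁻¹) * cs.simple j = cs.simple i ↔
        ρ ^ (2 * n + 1) * t = cs.simple j := by
      rw [← mul_right_inj (cs.simple j), ← mul_left_inj (cs.simple j), hij]
      simp only [mul_assoc, cs.simple_mul_simple_self, mul_one,
        cs.simple_mul_simple_cancel_left]
      rw [← mul_assoc (ρ ^ n), mul_inv_eq_iff_eq_mul, mul_assoc, hj, eq_inv_mul_iff_mul_eq,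
        eq_inv_mul_iff_mul_eq, two_mul, add_assoc, pow_add, pow_succ']
      simp only [mul_assoc]
    rw [pow_succ', end_mul_apply, ih, end_mul_apply,
      ← hρ, mul_add, mul_one, Finset.sum_range_succ, Finset.sum_range_succ]
    simp only [signedConj, c1, c2]
    ext
    · simp [hρ, pow_succ', mul_assoc]
    · simp only [add_assoc]

theorem isLiftable_signedConj : M.IsLiftable (signedConj cs) := by
  intro i j
  refine funext fun ⟨t, ε⟩ => ?_
  rw [signedConj_mul_pow_apply, cs.simple_mul_simple_pow, two_mul, Finset.sum_range_add]
  simp only [pow_add, cs.simple_mul_simple_pow, one_mul]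
  rw [CharTwo.add_self_eq_zero]
  simp [end_one_apply]

/-- The inversion cocycle: for a reflection `t`, it records whether `t` is a right inversion
of `w`. -/
noncomputable def invCocycle (w t : W) : ZMod 2 :=
  (cs.lift ⟨signedConj cs, isLiftable_signedConj cs⟩ w (t, 0)).2

theorem lift_signedConj_apply (w t : W) (ε : ZMod 2) :
    cs.lift ⟨signedConj cs, isLiftable_signedConj cs⟩ w (t, ε) =
      (w * t * w⁻¹, ε + invCocycle cs w t) := by
  induction w using cs.simple_induction_left generalizing t ε with
  | one => simp [invCocycle, end_one_apply]
  | mul_simple_left w i ih =>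
    rw [invCocycle, map_mul, end_mul_apply, end_mul_apply, cs.lift_apply_simple, ih, ih]
    simp [signedConj, mul_assoc, add_assoc]

theorem invCocycle_mul (u v t : W) :
    invCocycle cs (u * v) t = invCocycle cs v t + invCocycle cs u (v * t * v⁻¹) := by
  rw [invCocycle, map_mul, end_mul_apply, lift_signedConj_apply,
    lift_signedConj_apply]
  simp

theorem invCocycle_one (t : W) : invCocycle cs 1 t = 0 := by
  simp [invCocycle, end_one_apply]

theorem invCocycle_simple (i : B) (t : W) :
    invCocycle cs (cs.simple i) t = if t = cs.simple i then 1 else 0 := by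
  simp [invCocycle, signedConj]

theorem mem_rightInvSeq_of_invCocycle_ne_zero {ω : List B} {t : W}
    (h : invCocycle cs (cs.wordProd ω) t ≠ 0) : t ∈ cs.rightInvSeq ω := by
  induction ω with
  | nil => simp [invCocycle_one] at h
  | cons i ω ih =>
    rw [CoxeterSystem.rightInvSeq, List.mem_cons]
    rw [cs.wordProd_cons, invCocycle_mul, invCocycle_simple] at h
    by_cases ht : cs.wordProd ω * t * (cs.wordProd ω)⁻¹ = cs.simple i
    · left
      rw [← ht]
      group
    · exact .inr (ih (by simpa [ht] using h))

theorem invCocycle_self {t : W} (ht : cs.IsReflection t) : invCocycle cs t t = 1 := by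
  obtain ⟨u, i, rfl⟩ := ht
  have h := invCocycle_mul cs u u⁻¹ (u * cs.simple i * u⁻¹)
  rw [mul_inv_cancel, invCocycle_one] at h
  rw [invCocycle_mul, invCocycle_mul]
  simp only [inv_inv, mul_assoc, inv_mul_cancel_left, inv_mul_cancel, mul_one, one_mul,
    cs.simple_mul_simple_self, invCocycle_simple, cs.inv_simple, if_true] at h ⊢
  linear_combination -h

/-- The strong exchange condition, phrased through the inversion cocycle. -/
theorem invCocycle_ne_zero_iff {w t : W} (ht : cs.IsReflection t) :
    invCocycle cs w t ≠ 0 ↔ cs.length (w * t) < cs.length w := by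
  have key (w : W) (h : invCocycle cs w t ≠ 0) : cs.length (w * t) < cs.length w := by
    obtain ⟨ω, hω, rfl⟩ := cs.exists_isReduced w
    exact (cs.isRightInversion_of_mem_rightInvSeq hω
      (mem_rightInvSeq_of_invCocycle_ne_zero cs h)).2
  refine ⟨key w, fun h h0 => ?_⟩
  have h1 := key (w * t)
  rw [invCocycle_mul, mul_assoc, mul_inv_cancel, mul_one, mul_assoc, ht.mul_self, mul_one,
    invCocycle_self cs ht, h0] at h1
  exact absurd (h1 (by simp)) h.not_gt

theorem invCocycle_eq_zero_iff {w t : W} (ht : cs.IsReflection t) :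
    invCocycle cs w t = 0 ↔ cs.length w < cs.length (w * t) := by
  rw [← not_iff_not, ← ne_eq, invCocycle_ne_zero_iff cs ht, not_lt]
  exact ⟨le_of_lt, fun h => h.lt_of_ne (ht.length_mul_left_ne w)⟩

theorem invCocycle_simple_eq_zero_iff {w : W} {i : B} :
    invCocycle cs w (cs.simple i) = 0 ↔ cs.length (w * cs.simple i) = cs.length w + 1 := by
  rw [invCocycle_eq_zero_iff cs (cs.isReflection_simple i)]
  have := cs.length_mul_simple w i
  omega

/-- Every word contains a reduced subword with the same product. -/
theorem exists_isReduced_sublist (ω : List B) :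
    ∃ ω', ω'.Sublist ω ∧ cs.IsReduced ω' ∧ cs.wordProd ω' = cs.wordProd ω := by
  induction ω using List.reverseRecOn with
  | nil => exact ⟨[], .refl _, by simp [CoxeterSystem.IsReduced], rfl⟩
  | append_singleton ω i ih =>
    obtain ⟨ω', hs, hr, hp⟩ := ih
    by_cases h : invCocycle cs (cs.wordProd ω') (cs.simple i) = 0
    · refine ⟨ω' ++ [i], hs.append (.refl _), ?_, by simp [cs.wordProd_append, hp]⟩
      rw [CoxeterSystem.IsReduced, cs.wordProd_append, cs.wordProd_singleton,
        (invCocycle_simple_eq_zero_iff cs).1 h, hr.eq, List.length_append, List.length_singleton]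
    · obtain ⟨k, hk, hki⟩ := List.mem_iff_getElem.1 (mem_rightInvSeq_of_invCocycle_ne_zero cs h)
      have hprod := cs.wordProd_mul_getD_rightInvSeq ω' k
      rw [List.getD_eq_getElem _ 1 hk, hki] at hprod
      refine ⟨ω'.eraseIdx k, ((List.eraseIdx_sublist _ _).trans hs).trans
        (List.sublist_append_left _ _), ?_, by simp [cs.wordProd_append, ← hp, hprod]⟩
      rw [cs.length_rightInvSeq] at hk
      have h1 := cs.length_mul_simple (cs.wordProd ω') i
      have h2 := List.length_eraseIdx_add_one hk
      have h3 := cs.length_wordProd_le (ω'.eraseIdx k)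
      rw [CoxeterSystem.IsReduced]
      rw [hprod, hr.eq] at h1
      omega

end Cocycle
section Parabolic

variable (cs : CoxeterSystem M W) {J K : Set B}

theorem simple_mem_WJ {j : B} (hj : j ∈ J) : cs.simple j ∈ WJ cs J :=
  Subgroup.subset_closure ⟨j, hj, rfl⟩

theorem wordProd_mem_WJ {ω : List B} (h : ∀ i ∈ ω, i ∈ J) : cs.wordProd ω ∈ WJ cs J :=
  Subgroup.list_prod_mem _ fun _ hx => by
    obtain ⟨i, hi, rfl⟩ := List.mem_map.1 hx
    exact simple_mem_WJ cs (h i hi)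

theorem exists_isReduced_of_mem_WJ {a : W} (ha : a ∈ WJ cs J) :
    ∃ ω : List B, (∀ i ∈ ω, i ∈ J) ∧ cs.IsReduced ω ∧ cs.wordProd ω = a := by
  obtain ⟨ω, hω, rfl⟩ : ∃ ω : List B, (∀ i ∈ ω, i ∈ J) ∧ cs.wordProd ω = a := by
    induction ha using Subgroup.closure_induction with
    | mem x hx =>
      obtain ⟨j, hj, rfl⟩ := hx
      exact ⟨[j], by simpa using hj, by simp⟩
    | one => exact ⟨[], by simp, by simp⟩
    | mul x y _ _ hx hy =>
      obtain ⟨ω₁, h₁, rfl⟩ := hx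
      obtain ⟨ω₂, h₂, rfl⟩ := hy
      refine ⟨ω₁ ++ ω₂, fun i hi => ?_, cs.wordProd_append _ _⟩
      exact (List.mem_append.1 hi).elim (h₁ i) (h₂ i)
    | inv x _ hx =>
      obtain ⟨ω, h, rfl⟩ := hx
      exact ⟨ω.reverse, by simpa using h, by simp⟩
  obtain ⟨ω', hs, hr, hp⟩ := exists_isReduced_sublist cs ω
  exact ⟨ω', fun i hi => hω i (hs.subset hi), hr, hp⟩

theorem mem_WJ_of_invCocycle_ne_zero {a t : W} (ha : a ∈ WJ cs J)
    (h : invCocycle cs a t ≠ 0) : t ∈ WJ cs J := by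
  obtain ⟨ω, hω, -, rfl⟩ := exists_isReduced_of_mem_WJ cs ha
  obtain ⟨k, hk, hki⟩ := List.mem_iff_getElem.1 (mem_rightInvSeq_of_invCocycle_ne_zero cs h)
  have hprod := cs.wordProd_mul_getD_rightInvSeq ω k
  rw [List.getD_eq_getElem _ 1 hk, hki] at hprod
  rw [← Subgroup.mul_mem_cancel_left _ ha, hprod]
  exact wordProd_mem_WJ cs fun i hi => hω i ((List.eraseIdx_sublist _ _).subset hi)

theorem invCocycle_eq_zero_of_mem_Xleft {u t : W} (hu : u ∈ Xleft cs J) (ht : cs.IsReflection t)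
    (htJ : t ∈ WJ cs J) : invCocycle cs u t = 0 := by
  rw [invCocycle_eq_zero_iff cs ht]
  exact (hu t htJ).lt_of_ne (ht.length_mul_left_ne u).symm

theorem eq_one_of_mem_WJ {a : W} (ha : a ∈ WJ cs J)
    (h : ∀ j ∈ J, invCocycle cs a (cs.simple j) = 0) : a = 1 := by
  obtain ⟨ω, hω, hr, rfl⟩ := exists_isReduced_of_mem_WJ cs ha
  rcases List.eq_nil_or_concat' ω with rfl | ⟨ω, j, rfl⟩
  · simp
  · have h1 := (invCocycle_simple_eq_zero_iff cs).1 (h j (hω j (by simp)))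
    have h2 := cs.length_wordProd_le ω
    rw [hr.eq, cs.wordProd_append, cs.wordProd_singleton, cs.simple_mul_simple_cancel_right] at h1
    simp at h1
    omega

theorem exists_mem_Xleft (J : Set B) (w : W) :
    ∃ u ∈ Xleft cs J, ∃ a ∈ WJ cs J, w = u * a := by
  obtain ⟨a, ha⟩ := exists_minimal_of_wellFoundedLT (fun n => ∃ a ∈ WJ cs J, cs.length (w * a) = n)
    ⟨_, 1, one_mem _, rfl⟩
  obtain ⟨⟨a, haJ, rfl⟩, hmin⟩ := ha
  refine ⟨w * a, fun u hu => ?_, a⁻¹, inv_mem haJ, by simp⟩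
  rw [mul_assoc]
  by_contra hlt
  exact hlt (hmin ⟨a * u, mul_mem haJ hu, rfl⟩ (not_le.1 hlt).le)

theorem mem_Xleft_iff {w : W} :
    w ∈ Xleft cs J ↔ ∀ j ∈ J, invCocycle cs w (cs.simple j) = 0 := by
  refine ⟨fun h j hj => invCocycle_eq_zero_of_mem_Xleft cs h (cs.isReflection_simple j)
    (simple_mem_WJ cs hj), fun h => ?_⟩
  obtain ⟨u, hu, a, ha, rfl⟩ := exists_mem_Xleft cs J w
  suffices a = 1 by simpa [this] using hu
  refine eq_one_of_mem_WJ cs ha fun j hj => ?_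
  have h1 := h j hj
  rwa [invCocycle_mul, invCocycle_eq_zero_of_mem_Xleft cs hu
    ((cs.isReflection_simple j).conj a)
    (mul_mem (mul_mem ha (simple_mem_WJ cs hj)) (inv_mem ha)), add_zero] at h1

theorem length_mul_of_mem_Xleft {u a : W} (hu : u ∈ Xleft cs J) (ha : a ∈ WJ cs J) :
    cs.length (u * a) = cs.length u + cs.length a := by
  obtain ⟨ω, hω, hr, rfl⟩ := exists_isReduced_of_mem_WJ cs ha
  clear ha
  induction ω using List.reverseRecOn with
  | nil => simp
  | append_singleton ω j ih =>
    have hr' : cs.IsReduced ω := by simpa using hr.take ω.length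
    have hωJ : ∀ i ∈ ω, i ∈ J := fun i hi => hω i (by simp [hi])
    have ha := wordProd_mem_WJ cs hωJ
    have hj := simple_mem_WJ cs (hω j (by simp))
    have h0 : invCocycle cs (cs.wordProd ω) (cs.simple j) = 0 := by
      rw [invCocycle_simple_eq_zero_iff, ← cs.wordProd_singleton, ← cs.wordProd_append, hr.eq,
        hr'.eq]
      simp
    have h1 : invCocycle cs (u * cs.wordProd ω) (cs.simple j) = 0 := by
      rw [invCocycle_mul, h0, invCocycle_eq_zero_of_mem_Xleft cs hu
        ((cs.isReflection_simple j).conj _) (mul_mem (mul_mem ha hj) (inv_mem ha)), add_zero]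
    rw [invCocycle_simple_eq_zero_iff] at h0 h1
    rw [cs.wordProd_append, cs.wordProd_singleton, ← mul_assoc, h1, h0, ih hωJ hr', add_assoc]

theorem eq_of_mem_Xleft {u u' : W} (hu : u ∈ Xleft cs J) (hu' : u' ∈ Xleft cs J)
    (h : u⁻¹ * u' ∈ WJ cs J) : u = u' := by
  have h1 := length_mul_of_mem_Xleft cs hu h
  have h2 := hu' _ (inv_mem h)
  rw [mul_inv_cancel_left] at h1
  rw [mul_inv_rev, inv_inv, mul_inv_cancel_left] at h2
  rw [← inv_mul_eq_one, ← cs.length_eq_zero_iff]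
  omega

theorem mem_Xright_iff {w : W} : w ∈ Xright cs J ↔ w⁻¹ ∈ Xleft cs J := by
  constructor
  · intro h u hu
    rw [← cs.length_inv (w⁻¹ * u), cs.length_inv, mul_inv_rev, inv_inv]
    exact h _ (inv_mem hu)
  · intro h u hu
    rw [← cs.length_inv (u * w), ← cs.length_inv w, mul_inv_rev]
    exact h _ (inv_mem hu)

theorem length_mul_of_mem_Xright {a x : W} (hx : x ∈ Xright cs J) (ha : a ∈ WJ cs J) :
    cs.length (a * x) = cs.length a + cs.length x := by
  rw [← cs.length_inv (a * x), mul_inv_rev,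
    length_mul_of_mem_Xleft cs ((mem_Xright_iff cs).1 hx) (inv_mem ha), cs.length_inv,
    cs.length_inv, add_comm]

theorem eq_of_mem_Xright {x x' : W} (hx : x ∈ Xright cs J) (hx' : x' ∈ Xright cs J)
    (h : x * x'⁻¹ ∈ WJ cs J) : x = x' := by
  rw [mem_Xright_iff] at hx hx'
  exact inv_injective (eq_of_mem_Xleft cs hx hx' (by rwa [inv_inv]))

theorem exists_mem_Xright (J : Set B) (w : W) :
    ∃ x ∈ Xright cs J, ∃ a ∈ WJ cs J, w = a * x := by
  obtain ⟨u, hu, a, ha, h⟩ := exists_mem_Xleft cs J w⁻¹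
  exact ⟨u⁻¹, by rwa [mem_Xright_iff, inv_inv], a⁻¹, inv_mem ha, by
    rw [← mul_inv_rev, ← h, inv_inv]⟩

theorem mem_of_simple_mem_WJ {i : B} (h : cs.simple i ∈ WJ cs J) : i ∈ J := by
  by_contra hi
  have h1 : cs.simple i ∈ Xleft cs J := by
    refine (mem_Xleft_iff cs).2 fun j hj => ?_
    rw [invCocycle_simple, if_neg]
    intro hji
    exact hi (simple_injective cs hji ▸ hj)
  simpa using h1 _ h

end Parabolic

section DoubleCoset

variable (cs : CoxeterSystem M W) {J K : Set B}

/-- The set `x⁻¹ J x ∩ K`, as a set of indices. -/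
def doubleCosetIndex (J K : Set B) (x : W) : Set B :=
  {k | k ∈ K ∧ ∃ j ∈ J, x * cs.simple k * x⁻¹ = cs.simple j}

theorem simple_image_doubleCosetIndex (J K : Set B) (x : W) :
    cs.simple '' doubleCosetIndex cs J K x =
      (fun s => x⁻¹ * s * x) '' (cs.simple '' J) ∩ (cs.simple '' K) := by
  ext t
  constructor
  · rintro ⟨k, ⟨hk, j, hj, h⟩, rfl⟩
    exact ⟨⟨_, ⟨j, hj, rfl⟩, by simp [← h, mul_assoc]⟩, k, hk, rfl⟩
  · rintro ⟨⟨_, ⟨j, hj, rfl⟩, h⟩, k, hk, rfl⟩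
    exact ⟨k, ⟨hk, j, hj, by simp [← h, mul_assoc]⟩, rfl⟩

theorem mem_doubleCosetIndex {x : W} (hxJ : x ∈ Xright cs J) (hxK : x ∈ Xleft cs K) {k : B}
    (hk : k ∈ K) (h : x * cs.simple k * x⁻¹ ∈ WJ cs J) : k ∈ doubleCosetIndex cs J K x := by
  have h1 := length_mul_of_mem_Xright cs hxJ h
  have h2 := (invCocycle_simple_eq_zero_iff cs).1 ((mem_Xleft_iff cs).1 hxK k hk)
  rw [inv_mul_cancel_right, h2, add_comm, add_right_cancel_iff] at h1
  obtain ⟨i, hi⟩ := cs.length_eq_one_iff.1 h1.symm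
  exact ⟨hk, i, mem_of_simple_mem_WJ cs (hi ▸ h), hi⟩

theorem mul_mem_Xleft_iff {x a u : W} (hxJ : x ∈ Xright cs J) (hxK : x ∈ Xleft cs K)
    (ha : a ∈ WJ cs J) (hu : u ∈ Xleft cs J) :
    a * x ∈ Xleft cs K ↔ u * a * x ∈ Xleft cs (doubleCosetIndex cs J K x) := by
  have hx0 := (mem_Xleft_iff cs).1 hxK
  rw [mem_Xleft_iff, mem_Xleft_iff]
  have key : ∀ k ∈ doubleCosetIndex cs J K x,
      invCocycle cs (u * a * x) (cs.simple k) = invCocycle cs (a * x) (cs.simple k) := by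
    rintro k ⟨hk, j, hj, h⟩
    rw [invCocycle_mul, invCocycle_mul, invCocycle_mul, h, invCocycle_eq_zero_of_mem_Xleft cs hu
      ((cs.isReflection_simple j).conj a)
      (mul_mem (mul_mem ha (simple_mem_WJ cs hj)) (inv_mem ha)), add_zero]
  refine ⟨fun h k hk => (key k hk).trans (h k hk.1), fun h k hk => ?_⟩
  by_cases hkL : k ∈ doubleCosetIndex cs J K x
  · exact (key k hkL).symm.trans (h k hkL)
  · rw [invCocycle_mul, hx0 k hk, zero_add]
    by_contra hne
    exact hkL (mem_doubleCosetIndex cs hxJ hxK hk (mem_WJ_of_invCocycle_ne_zero cs ha hne))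

theorem mem_Xleft_of_mul_mem {x a : W} (hxJ : x ∈ Xright cs J) (ha : a ∈ WJ cs J)
    (h : a * x ∈ Xleft cs K) : x ∈ Xleft cs K := by
  refine (mem_Xleft_iff cs).2 fun k hk => ?_
  have h1 := (invCocycle_simple_eq_zero_iff cs).1 ((mem_Xleft_iff cs).1 h k hk)
  rw [length_mul_of_mem_Xright cs hxJ ha, mul_assoc] at h1
  rw [invCocycle_simple_eq_zero_iff]
  have h2 := cs.length_mul_le a (x * cs.simple k)
  have h3 := cs.length_mul_simple x k
  omega

theorem card_factorizations (J K : Set B) (w : W) :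
    {v : W | v ∈ Xleft cs K ∧ w * v⁻¹ ∈ Xleft cs J}.ncard =
      {x : W | (x ∈ Xright cs J ∧ x ∈ Xleft cs K) ∧
        w ∈ Xleft cs (doubleCosetIndex cs J K x)}.ncard := by
  choose r hr a ha hra using exists_mem_Xright cs J
  refine Set.ncard_congr (fun v _ => r v) ?_ ?_ ?_
  · rintro v ⟨hv, hwv⟩
    have hrK := mem_Xleft_of_mul_mem cs (hr v) (ha v) (hra v ▸ hv)
    refine ⟨⟨hr v, hrK⟩, ?_⟩
    have h := (mul_mem_Xleft_iff cs (hr v) hrK (ha v) hwv).1 (hra v ▸ hv)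
    rwa [mul_assoc, ← hra, inv_mul_cancel_right] at h
  · rintro v v' ⟨hv, hwv⟩ ⟨hv', hwv'⟩ h
    have h1 : w * v⁻¹ = w * v'⁻¹ := by
      refine eq_of_mem_Xleft cs hwv hwv' ?_
      have : (w * v⁻¹)⁻¹ * (w * v'⁻¹) = a v * (a v')⁻¹ := by
        calc (w * v⁻¹)⁻¹ * (w * v'⁻¹) = v * v'⁻¹ := by group
          _ = (a v * r v) * (a v' * r v')⁻¹ := by rw [← hra, ← hra]
          _ = a v * (a v')⁻¹ := by rw [show r v = r v' from h]; group
      exact this ▸ mul_mem (ha v) (inv_mem (ha v'))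
    exact inv_injective (mul_left_cancel h1)
  · rintro x ⟨⟨hxJ, hxK⟩, hw⟩
    obtain ⟨u, hu, b, hb, hub⟩ := exists_mem_Xleft cs J (w * x⁻¹)
    have hwx : w = u * b * x := by rw [← hub, inv_mul_cancel_right]
    refine ⟨b * x, ⟨(mul_mem_Xleft_iff cs hxJ hxK hb hu).2 (hwx ▸ hw), ?_⟩, ?_⟩
    · rwa [hwx, mul_assoc u, mul_inv_cancel_right]
    · refine eq_of_mem_Xright cs (hr _) hxJ ?_
      have : r (b * x) * x⁻¹ = (a (b * x))⁻¹ * b := by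
        rw [eq_inv_mul_iff_mul_eq, ← mul_assoc, ← hra, mul_inv_cancel_right]
      exact this ▸ mul_mem (inv_mem (ha _)) hb

end DoubleCoset
section DescentAlgebra

variable (cs : CoxeterSystem M W)

theorem aJKL_eq_ncard (J K L : Set B) :
    aJKL cs J K L = {x : W | (x ∈ Xright cs J ∧ x ∈ Xleft cs K) ∧
      doubleCosetIndex cs J K x = L}.ncard := by
  rw [aJKL, Nat.card_coe_set_eq]
  simp only [← simple_image_doubleCosetIndex,
    (simple_injective cs).image_injective.eq_iff, and_assoc]

variable [Fintype W]

theorem XX_eq_sum_smul (J : Set B) :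
    XX cs J = ∑ w : W, (if w ∈ Xleft cs J then (1 : ℚ) else 0) • MonoidAlgebra.of ℚ W w := by
  simp only [XX, ite_smul, one_smul, zero_smul]

theorem XX_mul_XX (J K : Set B) :
    XX cs J * XX cs K = ∑ w : W,
      ({v : W | v ∈ Xleft cs K ∧ w * v⁻¹ ∈ Xleft cs J}.ncard : ℚ) • MonoidAlgebra.of ℚ W w := by
  have h (w : W) : ({v : W | v ∈ Xleft cs K ∧ w * v⁻¹ ∈ Xleft cs J}.ncard : ℚ) =
      ∑ v : W, (if w * v⁻¹ ∈ Xleft cs J then (1 : ℚ) else 0) *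
        (if v ∈ Xleft cs K then (1 : ℚ) else 0) := by
    rw [Set.ncard_eq_toFinset_card', Finset.card_eq_sum_ones, Set.toFinset_ofPred,
      Finset.sum_filter, Nat.cast_sum]
    refine Finset.sum_congr rfl fun v _ => ?_
    by_cases h1 : v ∈ Xleft cs K <;> by_cases h2 : w * v⁻¹ ∈ Xleft cs J <;> simp [h1, h2]
  simp only [h, Finset.sum_smul]
  rw [XX_eq_sum_smul, XX_eq_sum_smul, Finset.sum_mul_sum, Finset.sum_comm]
  refine Eq.trans ?_ Finset.sum_comm
  refine Finset.sum_congr rfl fun v _ => ?_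
  refine Fintype.sum_equiv (Equiv.mulRight v) _ _ fun u => ?_
  rw [smul_mul_smul_comm, ← map_mul, Equiv.coe_mulRight, mul_inv_cancel_right]

theorem sum_aJKL_smul_XX [Fintype B] (J K : Set B) :
    ∑ L : Set B, (aJKL cs J K L : ℚ) • XX cs L = ∑ w : W,
      ({x : W | (x ∈ Xright cs J ∧ x ∈ Xleft cs K) ∧
        w ∈ Xleft cs (doubleCosetIndex cs J K x)}.ncard : ℚ) • MonoidAlgebra.of ℚ W w := by
  simp only [XX_eq_sum_smul, Finset.smul_sum, smul_smul]
  rw [Finset.sum_comm]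
  refine Finset.sum_congr rfl fun w _ => ?_
  rw [← Finset.sum_smul]
  congr 1
  simp only [aJKL_eq_ncard, Set.ncard_eq_toFinset_card', Set.toFinset_ofPred,
    ← Finset.filter_filter]
  rw [Finset.card_eq_sum_ones, Finset.sum_filter,
    ← Finset.sum_fiberwise _ (doubleCosetIndex cs J K)]
  push_cast
  refine Finset.sum_congr rfl fun L _ => ?_
  rw [Finset.card_eq_sum_ones, Nat.cast_sum, Finset.sum_mul]
  refine Finset.sum_congr rfl fun x hx => ?_
  rw [(Finset.mem_filter.1 hx).2]
  simp

theorem XX_univ : XX cs Set.univ = 1 := by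
  have h (w : W) : w ∈ Xleft cs Set.univ ↔ w = 1 := by
    rw [Xleft, WJ, Set.image_univ, cs.subgroup_closure_range_simple]
    constructor
    · intro h
      simpa using h w⁻¹ trivial
    · rintro rfl u -
      simp
  simp only [XX, h, Finset.sum_ite_eq', Finset.mem_univ, if_true, map_one]

end DescentAlgebra

/-- **Solomon's theorem.**  In a finite Coxeter system `(W, S)`, for all `J, K ⊆ S`
one has `𝒳_J 𝒳_K = Σ_L a_{JKL} 𝒳_L`; in particular the `ℚ`-span of the `𝒳_J` is a
subalgebra of `ℚ[W]`, the descent algebra of `W`. -/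
theorem solomon_multiplication_rule {B W : Type*} [Group W] [Fintype W] [Fintype B]
    {M : CoxeterMatrix B} (cs : CoxeterSystem M W) :
    (∀ J K : Set B,
        XX cs J * XX cs K = ∑ L : Set B, (aJKL cs J K L : ℚ) • XX cs L) ∧
      ∃ A : Subalgebra ℚ (MonoidAlgebra ℚ W),
        A.toSubmodule = Submodule.span ℚ (Set.range fun J : Set B => XX cs J) := by
  have hmul (J K : Set B) :
      XX cs J * XX cs K = ∑ L : Set B, (aJKL cs J K L : ℚ) • XX cs L := by
    simp only [XX_mul_XX, sum_aJKL_smul_XX, card_factorizations]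
  refine ⟨hmul, Submodule.toSubalgebra _ ?_ ?_, Submodule.toSubalgebra_toSubmodule _ _ _⟩
  · rw [← XX_univ cs]
    exact Submodule.subset_span ⟨_, rfl⟩
  · intro x y hx hy
    have hxy := Submodule.mul_mem_mul hx hy
    rw [Submodule.span_mul_span] at hxy
    refine Submodule.span_le.2 ?_ hxy
    rintro _ ⟨_, ⟨J, rfl⟩, _, ⟨K, rfl⟩, rfl⟩
    change XX cs J * XX cs K ∈ Submodule.span ℚ _
    rw [hmul]
    exact Submodule.sum_mem _ fun L _ =>
      Submodule.smul_mem _ _ (Submodule.subset_span ⟨L, rfl⟩)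

end SolomonRule
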